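/- Let q ≥ 3 be a power of an odd prime, let m ≥ 9 with m ≡ 0 (mod 3), and n = (q^m−1)/2. For 2 ≤ i ≤ 10, let δ_i′ be the i-th largest odd q-cyclotomic coset leader modulo 2n. Then the negacyclic BCH code C_{(n,−1,(δ_i′+1)/2,0)} over F_q has dimension exactly i·m − 2m/3; equivalently, the number of odd s ∈ {1,…,2n−1} lying outside ∪_{t=1}^{δ_i′−2} C_t^{2n} equals i·m − 2m/3. -/

import Mathlib

open Finset

/-- The `q`-cyclotomic coset of `i` modulo `N`, as a subset of `ZMod N`. -/
def qCoset (q N i : ℕ) : Set (ZMod N) :=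
  Set.range fun j : ℕ => (i : ZMod N) * (q : ZMod N) ^ j

/-- The odd `q`-cyclotomic coset leaders modulo `N`. -/
noncomputable def oddLeaders (q N : ℕ) : Finset ℕ := by
  classical
  exact (Finset.range N).filter fun s => Odd s ∧ ∀ j : ℕ, s ≤ (s * q ^ j) % N

/-- `x` is the `i`-th largest element of the finite set `S` (1-indexed). -/
def IsIthLargest (S : Finset ℕ) (i x : ℕ) : Prop :=
  x ∈ S ∧ (S.filter fun y => x ≤ y).card = i

/-- Evaluation of the polynomial with coefficient vector `c` at the point `x`
of an extension field. -/
noncomputable def evalAt (F : Type*) {E : Type*} [Field F] [Field E] [Algebra F E]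
    (n : ℕ) (x : E) : (Fin n → F) →ₗ[F] E where
  toFun c := ∑ j : Fin n, c j • x ^ (j : ℕ)
  map_add' a b := by simp [add_smul, Finset.sum_add_distrib]
  map_smul' r a := by simp [Finset.smul_sum, smul_smul]

/-- The negacyclic BCH code `C_(n,-1,δ,b)`: all words whose polynomial vanishes at
`γ^(1+2i)` for `b ≤ i ≤ b+δ-2`, where `γ` is a primitive `2n`-th root of unity. -/
noncomputable def negaBCH (F : Type*) {E : Type*} [Field F] [Field E] [Algebra F E]
    (n : ℕ) (γ : E) (δ b : ℕ) : Submodule F (Fin n → F) :=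
  ⨅ i ∈ Finset.Icc b (b + δ - 2), LinearMap.ker (evalAt F n (γ ^ (1 + 2 * i)))

/-- The cyclic BCH code `C_(n,1,δ,b)`: all words whose polynomial vanishes at
`β^i` for `b ≤ i ≤ b+δ-2`, where `β` is a primitive `n`-th root of unity. -/
noncomputable def cyclicBCH (F : Type*) {E : Type*} [Field F] [Field E] [Algebra F E]
    (n : ℕ) (β : E) (δ b : ℕ) : Submodule F (Fin n → F) :=
  ⨅ i ∈ Finset.Icc b (b + δ - 2), LinearMap.ker (evalAt F n (β ^ i))

/-- The dual code under the standard inner product. -/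
def dualCode {F : Type*} [Field F] {n : ℕ} (C : Submodule F (Fin n → F)) :
    Submodule F (Fin n → F) where
  carrier := {y | ∀ c ∈ C, ∑ j, y j * c j = 0}
  add_mem' := by
    intro a b ha hb c hc
    simp only [Set.mem_setOf_eq] at *
    simp [Pi.add_apply, add_mul, Finset.sum_add_distrib, ha c hc, hb c hc]
  zero_mem' := by intro c hc; simp
  smul_mem' := by
    intro r y hy c hc
    simp only [Set.mem_setOf_eq] at *
    simp [Pi.smul_apply, smul_eq_mul, mul_assoc, ← Finset.mul_sum, hy c hc]

/-- The extended code of a code of length `n`. -/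
def extendedCode {F : Type*} [Field F] {n : ℕ} (C : Submodule F (Fin n → F)) :
    Submodule F (Fin (n + 1) → F) where
  carrier := {x | (fun j : Fin n => x j.castSucc) ∈ C ∧ ∑ i, x i = 0}
  add_mem' := by
    intro a b ha hb
    exact ⟨C.add_mem ha.1 hb.1, by simp [Finset.sum_add_distrib, ha.2, hb.2]⟩
  zero_mem' := ⟨C.zero_mem, by simp⟩
  smul_mem' := by
    intro r x hx
    exact ⟨C.smul_mem r hx.1, by simp [← Finset.mul_sum, hx.2]⟩

/-- Hamming weight of a word. -/
noncomputable def hWt {F : Type*} [Field F] {n : ℕ} (c : Fin n → F) : ℕ := by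
  classical exact hammingNorm c

/-- `d` is the minimum Hamming distance of the code `C`. -/
def minDistIs {F : Type*} [Field F] {n : ℕ} (C : Submodule F (Fin n → F)) (d : ℕ) : Prop :=
  IsLeast {w : ℕ | ∃ c ∈ C, c ≠ 0 ∧ hWt c = w} d

/-- The `j`-fold cyclic shift `t ↦ t q ^ j mod N` of a residue `t`. -/
def shiftMod (q N t j : ℕ) : ℕ := t * q ^ j % N

/-- `t` is an odd nonzero residue that is the largest element of its cyclotomic coset. -/
def IsOddTop (q N t : ℕ) : Prop :=
  0 < t ∧ t < N ∧ Odd t ∧ ∀ j, shiftMod q N t j ≤ t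

/-- `t` returns to itself after `p` shifts and all intermediate shifts are smaller than `t`. -/
def HasTopPeriod (q N t p : ℕ) : Prop :=
  0 < p ∧ shiftMod q N t p = t ∧ ∀ l, 0 < l → l < p → shiftMod q N t l < t

theorem shiftMod_shiftMod (q N t i j : ℕ) :
    shiftMod q N (shiftMod q N t i) j = shiftMod q N t (i + j) := by
  simp [shiftMod, Nat.mod_mul_mod, pow_add, mul_assoc]

theorem shiftMod_zero {q N t : ℕ} (h : t < N) : shiftMod q N t 0 = t := by
  simp [shiftMod, Nat.mod_eq_of_lt h]

theorem shiftMod_lt {q N : ℕ} (t j : ℕ) (h : 0 < N) : shiftMod q N t j < N :=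
  Nat.mod_lt _ h

theorem shiftMod_mul_period {q N t p : ℕ} (hN : t < N) (h : shiftMod q N t p = t) (j : ℕ) :
    shiftMod q N t (p * j) = t := by
  induction j with
  | zero => simpa using shiftMod_zero hN
  | succ j ih => rw [Nat.mul_succ, ← shiftMod_shiftMod, ih, h]

theorem shiftMod_full {q m N t : ℕ} (hN : N + 1 = q ^ m) (h : t < N) :
    shiftMod q N t m = t := by
  rw [shiftMod, ← hN, mul_add, mul_one, add_comm, Nat.add_mul_mod_self_right,
    Nat.mod_eq_of_lt h]

theorem shiftMod_inv {q m N t : ℕ} (hm : 0 < m) (hN : N + 1 = q ^ m) (h : t < N) (j : ℕ) :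
    shiftMod q N (shiftMod q N t j) (j * (m - 1)) = t := by
  rw [shiftMod_shiftMod]
  have : j + j * (m - 1) = m * j := by
    obtain ⟨m, rfl⟩ : ∃ k, m = k + 1 := ⟨m - 1, by omega⟩
    simp; ring
  rw [this]
  exact shiftMod_mul_period h (shiftMod_full hN h) j

theorem shiftMod_pos {q m N t : ℕ} (hm : 0 < m) (hN : N + 1 = q ^ m) (h : t < N) (ht : 0 < t)
    (j : ℕ) : 0 < shiftMod q N t j := by
  by_contra h0
  have h1 := shiftMod_inv hm hN h j
  rw [Nat.eq_zero_of_not_pos h0] at h1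
  simp [shiftMod] at h1
  omega

theorem odd_shiftMod {q m N t : ℕ} (hq : Odd q) (hN : N + 1 = q ^ m) (ht : Odd t) (j : ℕ) :
    Odd (shiftMod q N t j) := by
  have hN2 : Even N := by
    have : Odd (N + 1) := hN ▸ hq.pow
    rcases this with ⟨x, hx⟩
    exact ⟨x, by omega⟩
  have h1 : Odd (t * q ^ j) := ht.mul hq.pow
  rw [← Nat.div_add_mod (t * q ^ j) N] at h1
  rw [add_comm] at h1
  exact (Nat.odd_add.1 h1).2 (hN2.mul_right _)

theorem shiftMod_compl {q m N t : ℕ} (hm : 0 < m) (hN : N + 1 = q ^ m) (h : t < N) (ht : 0 < t)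
    (j : ℕ) : shiftMod q N (N - t) j = N - shiftMod q N t j := by
  have h1 := shiftMod_pos hm hN h ht j
  have h2 := shiftMod_lt (q := q) t j (by omega : 0 < N)
  have h3 : shiftMod q N (N - t) j ≡ N - shiftMod q N t j [MOD N] := by
    have e : (N - t) * q ^ j + t * q ^ j ≡ (N - shiftMod q N t j) + shiftMod q N t j [MOD N] := by
      rw [← add_mul, Nat.sub_add_cancel h.le, Nat.sub_add_cancel h2.le]
      simp [Nat.ModEq]
    have e2 : t * q ^ j ≡ shiftMod q N t j [MOD N] := (Nat.mod_modEq _ _).symm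
    exact (Nat.mod_modEq _ _).trans (Nat.ModEq.add_right_cancel e2 e)
  exact h3.eq_of_lt_of_lt (shiftMod_lt _ _ (by omega)) (by omega)

theorem card_orbit {q m N t p : ℕ} (hm : 0 < m) (hN : N + 1 = q ^ m) (h : t < N)
    (hp : HasTopPeriod q N t p) : ((range p).image (shiftMod q N t)).card = p := by
  rw [card_image_of_injOn, card_range]
  have key : ∀ i j, i < j → j < p → shiftMod q N t i ≠ shiftMod q N t j := by
    intro i j hij hj he
    have h1 := shiftMod_inv hm hN h i
    rw [he, shiftMod_shiftMod, (by omega : j + i * (m - 1) = (i + i * (m - 1)) + (j - i)),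
      ← shiftMod_shiftMod, ← shiftMod_shiftMod, shiftMod_inv hm hN h i] at h1
    have := hp.2.2 (j - i) (by omega) (by omega)
    omega
  intro i hi j hj he
  simp only [coe_range, Set.mem_Iio] at hi hj
  rcases lt_trichotomy i j with hlt | heq | hgt
  · exact absurd he (key i j hlt hj)
  · exact heq
  · exact absurd he.symm (key j i hgt hi)

theorem shiftMod_mod_period {q N t p : ℕ} (h : t < N) (hp : shiftMod q N t p = t) (j : ℕ) :
    shiftMod q N t (j % p) = shiftMod q N t j := by
  conv_rhs => rw [← Nat.div_add_mod j p, ← shiftMod_shiftMod, shiftMod_mul_period h hp]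

theorem HasTopPeriod.le {q N t p : ℕ} (h : t < N) (hp : HasTopPeriod q N t p) (j : ℕ) :
    shiftMod q N t j ≤ t := by
  rw [← shiftMod_mod_period h hp.2.1]
  rcases Nat.eq_zero_or_pos (j % p) with h0 | h0
  · rw [h0, shiftMod_zero h]
  · exact (hp.2.2 _ h0 (Nat.mod_lt _ hp.1)).le

open Classical in
/-- The residues all of whose shifts are at most `τ` are counted by adding up the coset sizes of
the coset maxima that are at most `τ`. -/
theorem card_bounded_orbits {q m N τ : ℕ} (hq : Odd q) (hm : 0 < m) (hN : N + 1 = q ^ m)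
    (per : ℕ → ℕ) (hper : ∀ t, IsOddTop q N t → t ≤ τ → HasTopPeriod q N t (per t)) :
    ((range N).filter fun t => Odd t ∧ ∀ j, shiftMod q N t j ≤ τ).card =
      ∑ t ∈ (range N).filter (fun t => IsOddTop q N t ∧ t ≤ τ), per t := by
  have hu : ((range N).filter fun t => Odd t ∧ ∀ j, shiftMod q N t j ≤ τ) =
      ((range N).filter (fun t => IsOddTop q N t ∧ t ≤ τ)).biUnion
        (fun t => (range (per t)).image (shiftMod q N t)) := by
    ext w
    simp only [mem_filter, mem_range, mem_biUnion, mem_image]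
    constructor
    · rintro ⟨hw, ho, hb⟩
      obtain ⟨i, -, hi⟩ := exists_max_image (range m) (shiftMod q N w) ⟨0, by simpa using hm⟩
      have hi' : ∀ j, shiftMod q N w j ≤ shiftMod q N w i := fun j => by
        rw [← shiftMod_mod_period hw (shiftMod_full hN hw)]
        exact hi _ (by simpa using Nat.mod_lt _ hm)
      have htop : IsOddTop q N (shiftMod q N w i) := by
        refine ⟨shiftMod_pos hm hN hw ho.pos i, shiftMod_lt _ _ (by omega),
          odd_shiftMod hq hN ho i, fun j => ?_⟩
        rw [shiftMod_shiftMod]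
        exact hi' _
      have hp := hper _ htop (hb i)
      refine ⟨_, ⟨htop.2.1, htop, hb i⟩, (i * (m - 1)) % per (shiftMod q N w i),
        Nat.mod_lt _ hp.1, ?_⟩
      rw [shiftMod_mod_period htop.2.1 hp.2.1, shiftMod_inv hm hN hw]
    · rintro ⟨t, ⟨ht, htop, hτ⟩, j, -, rfl⟩
      refine ⟨shiftMod_lt _ _ (by omega), odd_shiftMod hq hN htop.2.2.1 j, fun l => ?_⟩
      rw [shiftMod_shiftMod]
      exact (htop.2.2.2 _).trans hτ
  rw [hu, card_biUnion]
  · refine sum_congr rfl fun t ht => ?_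
    simp only [mem_filter, mem_range] at ht
    exact card_orbit hm hN ht.1 (hper t ht.2.1 ht.2.2)
  · intro t ht t' ht' hne
    simp only [coe_filter, mem_range, Set.mem_ofPred_eq] at ht ht'
    rw [Function.onFun, Finset.disjoint_left]
    intro x hx hx'
    simp only [mem_image, mem_range] at hx hx'
    obtain ⟨i, -, rfl⟩ := hx
    obtain ⟨j, -, hj⟩ := hx'
    have h1 := shiftMod_inv hm hN ht.1 i
    have h2 := shiftMod_inv hm hN ht'.1 j
    rw [← hj, shiftMod_shiftMod] at h1
    rw [hj, shiftMod_shiftMod] at h2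
    have h3 := ht'.2.1.2.2.2 (j + i * (m - 1))
    have h4 := ht.2.1.2.2.2 (i + j * (m - 1))
    omega

theorem mem_range_algebraMap_of_pow_card_eq {F E : Type*} [Field F] [Fintype F] [Field E]
    [Algebra F E] {x : E} (h : x ^ Fintype.card F = x) : x ∈ Set.range (algebraMap F E) := by
  classical
  set P : Polynomial E := Polynomial.X ^ Fintype.card F - Polynomial.X with hP
  have hdeg : P.natDegree = Fintype.card F :=
    FiniteField.X_pow_card_sub_X_natDegree_eq E Fintype.one_lt_card
  have hP0 : P ≠ 0 := FiniteField.X_pow_card_sub_X_ne_zero E Fintype.one_lt_card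
  have hmem : ∀ y : E, y ∈ P.roots.toFinset ↔ y ^ Fintype.card F = y := fun y => by
    rw [Multiset.mem_toFinset, Polynomial.mem_roots hP0]
    simp [hP, sub_eq_zero]
  have hsub : univ.image (algebraMap F E) ⊆ P.roots.toFinset := by
    intro y hy
    obtain ⟨a, -, rfl⟩ := mem_image.1 hy
    rw [hmem, ← map_pow, FiniteField.pow_card]
  have hcard : P.roots.toFinset.card ≤ (univ.image (algebraMap F E)).card := by
    rw [card_image_of_injective _ (algebraMap F E).injective, card_univ, ← hdeg]
    exact (Multiset.toFinset_card_le _).trans (Polynomial.card_roots' _)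
  have hx := (hmem x).2 h
  rw [← eq_of_subset_of_card_le hsub hcard] at hx
  obtain ⟨a, -, ha⟩ := mem_image.1 hx
  exact ⟨a, ha⟩

/-- A finite set of points stable under the Frobenius map is the zero set of a monic polynomial
over the base field. -/
theorem exists_monic_map_eq_prod {F E : Type*} [Field F] [Fintype F] [Field E] [Algebra F E]
    (Z : Finset E) (hZ : ∀ z ∈ Z, z ^ Fintype.card F ∈ Z) :
    ∃ g : Polynomial F, g.Monic ∧ g.natDegree = Z.card ∧
      g.map (algebraMap F E) = ∏ z ∈ Z, (Polynomial.X - Polynomial.C z) := by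
  classical
  set P : Polynomial E := ∏ z ∈ Z, (Polynomial.X - Polynomial.C z) with hP
  have hmonic : P.Monic := Polynomial.monic_prod_X_sub_C _ _
  have hinj : Function.Injective (FiniteField.frobeniusAlgHom F E) :=
    (FiniteField.frobeniusAlgHom F E).toRingHom.injective
  have himg : Z.image (FiniteField.frobeniusAlgHom F E) = Z := by
    refine eq_of_subset_of_card_le ?_ (card_image_of_injective _ hinj).ge
    intro y hy
    obtain ⟨z, hz, rfl⟩ := mem_image.1 hy
    simpa using hZ z hz
  have hfix : P.map (FiniteField.frobeniusAlgHom F E).toRingHom = P := by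
    conv_rhs => rw [hP, ← himg, prod_image hinj.injOn]
    rw [hP, Polynomial.map_prod]
    simp
  have hlift : P ∈ Polynomial.lifts (algebraMap F E) := by
    rw [Polynomial.lifts_iff_coeff_lifts]
    intro k
    apply mem_range_algebraMap_of_pow_card_eq
    conv_rhs => rw [← hfix]
    simp
  obtain ⟨g, h1, h2, h3⟩ := Polynomial.lifts_and_natDegree_eq_and_monic hlift hmonic
  refine ⟨g, h3, ?_, h1⟩
  rw [h2, hP, Polynomial.natDegree_prod_of_monic _ _ fun z _ => Polynomial.monic_X_sub_C z]
  simp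

/-- The words vanishing on a Frobenius stable set `Z` form a space of codimension `|Z|`. -/
theorem finrank_iInf_ker_evalAt {F E : Type*} [Field F] [Fintype F] [Field E] [Algebra F E]
    (n : ℕ) (Z : Finset E) (hZ : ∀ z ∈ Z, z ^ Fintype.card F ∈ Z) (hn : Z.card ≤ n) :
    Module.finrank F (⨅ z ∈ Z, LinearMap.ker (evalAt F n z) : Submodule F (Fin n → F)) =
      n - Z.card := by
  classical
  obtain ⟨g, hg, hdeg, hmap⟩ := exists_monic_map_eq_prod (F := F) Z hZ
  let φ : (Fin n → F) →ₗ[F] Polynomial F :=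
    (Polynomial.modByMonicHom g) ∘ₗ (Polynomial.degreeLT F n).subtype ∘ₗ
      (Polynomial.degreeLTEquiv F n).symm.toLinearMap
  have hφ : ∀ c, φ c = ((Polynomial.degreeLTEquiv F n).symm c : Polynomial F) %ₘ g :=
    fun c => rfl
  have hev : ∀ (c : Fin n → F) (z : E), evalAt F n z c =
      Polynomial.aeval z ((Polynomial.degreeLTEquiv F n).symm c : Polynomial F) := by
    intro c z
    simp [evalAt, Polynomial.degreeLTEquiv, Polynomial.aeval_monomial, Algebra.smul_def]
  have hker : (⨅ z ∈ Z, LinearMap.ker (evalAt F n z) : Submodule F (Fin n → F)) =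
      LinearMap.ker φ := by
    ext c
    simp only [Submodule.mem_iInf, LinearMap.mem_ker, hev, hφ]
    set f : Polynomial F := ((Polynomial.degreeLTEquiv F n).symm c : Polynomial F)
    rw [Polynomial.modByMonic_eq_zero_iff_dvd hg, ← Polynomial.map_dvd_map' (algebraMap F E),
      hmap]
    constructor
    · intro h
      refine Finset.prod_dvd_of_coprime ?_ fun z hz => ?_
      · intro z _ w _ hzw
        exact Polynomial.pairwise_coprime_X_sub_C Function.injective_id hzw
      · rw [Polynomial.dvd_iff_isRoot, Polynomial.IsRoot, Polynomial.eval_map_algebraMap]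
        exact h z hz
    · intro h z hz
      have := (Finset.dvd_prod_of_mem (fun z => Polynomial.X - Polynomial.C z) hz).trans h
      rwa [Polynomial.dvd_iff_isRoot, Polynomial.IsRoot, Polynomial.eval_map_algebraMap] at this
  have hrange : LinearMap.range φ = Polynomial.degreeLT F Z.card := by
    ext f
    rw [LinearMap.mem_range, Polynomial.mem_degreeLT]
    constructor
    · rintro ⟨c, rfl⟩
      rw [hφ, ← hdeg, ← Polynomial.degree_eq_natDegree hg.ne_zero]
      exact Polynomial.degree_modByMonic_lt _ hg
    · intro hf
      refine ⟨Polynomial.degreeLTEquiv F n ⟨f, Polynomial.mem_degreeLT.2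
        (hf.trans_le (by exact_mod_cast hn))⟩, ?_⟩
      rw [hφ, LinearEquiv.symm_apply_apply, Polynomial.modByMonic_eq_self_iff hg,
        Polynomial.degree_eq_natDegree hg.ne_zero, hdeg]
      exact hf
  have h := LinearMap.finrank_range_add_finrank_ker φ
  rw [hrange, (Polynomial.degreeLTEquiv F Z.card).finrank_eq] at h
  simp only [Module.finrank_fin_fun] at h
  rw [hker]
  omega

theorem evalAt_pow_card_pow {F E : Type*} [Field F] [Fintype F] [Field E] [Algebra F E]
    {n : ℕ} {x : E} {c : Fin n → F} (h : evalAt F n x c = 0) (j : ℕ) :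
    evalAt F n (x ^ Fintype.card F ^ j) c = 0 := by
  induction j with
  | zero => simpa using h
  | succ j ih =>
    have : evalAt F n (x ^ Fintype.card F ^ (j + 1)) c =
        FiniteField.frobeniusAlgHom F E (evalAt F n (x ^ Fintype.card F ^ j) c) := by
      simp only [evalAt, LinearMap.coe_mk, AddHom.coe_mk, map_sum, map_smul, map_pow]
      simp only [FiniteField.coe_frobeniusAlgHom, pow_succ, pow_mul]
      refine sum_congr rfl fun i _ => ?_
      congr 1
      simp only [← pow_mul]
      congr 1
      ring
    rw [this, ih, map_zero]

theorem card_odd_range_two_mul (n : ℕ) : ((range (2 * n)).filter Odd).card = n := by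
  induction n with
  | zero => simp
  | succ n ih =>
    rw [Nat.mul_succ, range_add_one, range_add_one, filter_insert, filter_insert,
      if_pos ⟨n, rfl⟩, if_neg (by simp), card_insert_of_notMem (by simp), ih]

open Classical in
/-- The code with designed distance `(d + 1) / 2` has dimension the number of odd residues whose
whole coset is at least `d`. -/
theorem finrank_negaBCH_eq_card {q m n d : ℕ} (hq : Odd q) (hm : 0 < m)
    (hN : 2 * n + 1 = q ^ m) (hd : Odd d) (hd3 : 3 ≤ d) (hdN : d < 2 * n)
    {F E : Type*} [Field F] [Fintype F] [Field E] [Algebra F E]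
    (hF : Fintype.card F = q) {γ : E} (hγ : IsPrimitiveRoot γ (2 * n)) :
    Module.finrank F (negaBCH F n γ ((d + 1) / 2) 0) =
      ((range (2 * n)).filter fun s => Odd s ∧ ∀ j, d ≤ shiftMod q (2 * n) s j).card := by
  set U := (range (2 * n)).filter fun s => Odd s ∧ ∀ j, d ≤ shiftMod q (2 * n) s j with hU
  set T := (range (2 * n)).filter fun s => Odd s ∧ ¬ ∀ j, d ≤ shiftMod q (2 * n) s j with hT
  have hTU : U.card + T.card = n := by
    have := card_filter_add_card_filter_not (s := (range (2 * n)).filter Odd)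
      (fun s => ∀ j, d ≤ shiftMod q (2 * n) s j)
    rwa [filter_filter, filter_filter, card_odd_range_two_mul] at this
  have hpow : ∀ s j, γ ^ shiftMod q (2 * n) s j = (γ ^ s) ^ q ^ j := fun s j => by
    conv_lhs => rw [shiftMod, hγ.eq_orderOf, pow_mod_orderOf, pow_mul]
  set Z := T.image (γ ^ ·) with hZ
  have hZcard : Z.card = T.card := by
    apply card_image_of_injOn
    intro a ha b hb hab
    simp only [hT, coe_filter, mem_range, Set.mem_ofPred_eq] at ha hb
    exact hγ.pow_inj ha.1 hb.1 hab
  have hZfrob : ∀ z ∈ Z, z ^ Fintype.card F ∈ Z := by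
    intro z hz
    obtain ⟨s, hs, rfl⟩ := mem_image.1 hz
    simp only [hT, mem_filter, mem_range] at hs
    refine mem_image.2 ⟨shiftMod q (2 * n) s 1, ?_, by simp [hpow, hF]⟩
    simp only [hT, mem_filter, mem_range]
    refine ⟨shiftMod_lt _ _ (by omega), odd_shiftMod hq hN hs.2.1 1, fun h => hs.2.2 fun j => ?_⟩
    have h1 := h (m - 1 + j)
    rw [shiftMod_shiftMod, (by omega : 1 + (m - 1 + j) = m + j), ← shiftMod_shiftMod,
      shiftMod_full hN hs.1] at h1
    exact h1
  have heq : negaBCH F n γ ((d + 1) / 2) 0 = ⨅ z ∈ Z, LinearMap.ker (evalAt F n z) := by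
    obtain ⟨e, rfl⟩ := hd
    ext c
    simp only [negaBCH, Submodule.mem_iInf, LinearMap.mem_ker, Finset.mem_Icc]
    constructor
    · intro h z hz
      obtain ⟨s, hs, rfl⟩ := mem_image.1 hz
      simp only [hT, mem_filter, mem_range, not_forall, not_le] at hs
      obtain ⟨hs, ho, j, hj⟩ := hs
      obtain ⟨i, hi⟩ := odd_shiftMod hq hN ho j
      have h1 := h i ⟨by omega, by omega⟩
      rw [add_comm 1, ← hi] at h1
      have h2 := evalAt_pow_card_pow h1 (j * (m - 1))
      rwa [hF, ← hpow, shiftMod_inv hm hN hs] at h2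
    · intro h i hi
      refine h _ (mem_image_of_mem _ ?_)
      simp only [hT, mem_filter, mem_range]
      refine ⟨by omega, ⟨i, by ring⟩, fun h => ?_⟩
      have := h 0
      rw [shiftMod_zero (by omega)] at this
      omega
  rw [heq, finrank_iInf_ker_evalAt n Z hZfrob (by omega), hZcard]
  omega

theorem mem_iUnion_qCoset_iff {q m N s d : ℕ} (hq : Odd q) (hm : 0 < m) (hN : N + 1 = q ^ m)
    (hd : Odd d) (hdN : d < N) (hs : s < N) (ho : Odd s) :
    ((s : ZMod N) ∈ ⋃ t ∈ Set.Icc 1 (d - 2), qCoset q N t) ↔ ∃ j, shiftMod q N s j < d := by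
  have hcast : ∀ t j, (shiftMod q N t j : ZMod N) = (t : ZMod N) * (q : ZMod N) ^ j := fun t j => by
    simp [shiftMod]
  simp only [Set.mem_iUnion, Set.mem_Icc, qCoset, Set.mem_range, exists_prop, ← hcast]
  constructor
  · rintro ⟨t, ⟨h1, h2⟩, j, h⟩
    have hs' : shiftMod q N t j = s := by
      have := (ZMod.natCast_eq_natCast_iff' _ _ _).1 h
      rwa [Nat.mod_eq_of_lt hs, Nat.mod_eq_of_lt (shiftMod_lt _ _ (by omega))] at this
    refine ⟨j * (m - 1), ?_⟩
    rw [← hs', shiftMod_inv hm hN (by omega)]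
    omega
  · rintro ⟨j, hj⟩
    have h1 := odd_shiftMod hq hN ho j
    refine ⟨shiftMod q N s j, ⟨h1.pos, ?_⟩, j * (m - 1), ?_⟩
    · obtain ⟨x, hx⟩ := h1
      obtain ⟨y, hy⟩ := hd
      omega
    · rw [shiftMod_inv hm hN hs]

open Classical in
theorem card_filter_compl {q m N τ : ℕ} (hm : 0 < m) (hN : N + 1 = q ^ m) (hN2 : Even N)
    (hτ : τ ≤ N) :
    ((range N).filter fun s => Odd s ∧ ∀ j, N - τ ≤ shiftMod q N s j).card =
      ((range N).filter fun t => Odd t ∧ ∀ j, shiftMod q N t j ≤ τ).card := by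
  refine card_nbij' (N - ·) (N - ·) ?_ ?_ ?_ ?_
  · intro s hs
    simp only [coe_filter, mem_range, Set.mem_ofPred_eq] at hs ⊢
    have h0 := hs.2.1.pos
    refine ⟨by omega, Nat.Even.sub_odd hs.1.le hN2 hs.2.1, fun j => ?_⟩
    rw [shiftMod_compl hm hN hs.1 h0]
    have := hs.2.2 j
    omega
  · intro s hs
    simp only [coe_filter, mem_range, Set.mem_ofPred_eq] at hs ⊢
    have h0 := hs.2.1.pos
    refine ⟨by omega, Nat.Even.sub_odd hs.1.le hN2 hs.2.1, fun j => ?_⟩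
    rw [shiftMod_compl hm hN hs.1 h0]
    have := hs.2.2 j
    omega
  · intro s hs
    simp only [coe_filter, mem_range, Set.mem_ofPred_eq] at hs ⊢
    omega
  · intro s hs
    simp only [coe_filter, mem_range, Set.mem_ofPred_eq] at hs ⊢
    omega

open Classical in
/-- The complement of the `i`-th largest odd coset leader is the `i`-th smallest odd coset
maximum. -/
theorem IsIthLargest.compl {q m N i d : ℕ} (hm : 0 < m) (hN : N + 1 = q ^ m) (hN2 : Even N)
    (h : IsIthLargest (oddLeaders q N) i d) :
    d < N ∧ Odd d ∧ IsOddTop q N (N - d) ∧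
      ((range N).filter fun t => IsOddTop q N t ∧ t ≤ N - d).card = i := by
  have key : ∀ s, s ∈ oddLeaders q N → 0 < s ∧ s < N ∧ Odd s ∧ IsOddTop q N (N - s) := by
    intro s hs
    simp only [oddLeaders, mem_filter, mem_range] at hs
    have h0 := hs.2.1.pos
    refine ⟨h0, hs.1, hs.2.1, by omega, by omega, Nat.Even.sub_odd hs.1.le hN2 hs.2.1,
      fun j => ?_⟩
    rw [shiftMod_compl hm hN hs.1 h0]
    have : s ≤ shiftMod q N s j := hs.2.2 j
    omega
  obtain ⟨hd, hc⟩ := h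
  refine ⟨(key d hd).2.1, (key d hd).2.2.1, (key d hd).2.2.2, ?_⟩
  rw [← hc]
  symm
  refine card_nbij' (N - ·) (N - ·) ?_ ?_ ?_ ?_
  · intro s hs
    simp only [coe_filter, mem_range, Set.mem_ofPred_eq] at hs ⊢
    have := key s hs.1
    exact ⟨by omega, this.2.2.2, by omega⟩
  · intro t ht
    simp only [coe_filter, mem_range, Set.mem_ofPred_eq] at ht ⊢
    obtain ⟨h0, h1, h2, h3⟩ := ht.2.1
    refine ⟨?_, by have := key d hd; omega⟩
    simp only [oddLeaders, mem_filter, mem_range]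
    refine ⟨by omega, Nat.Even.sub_odd h1.le hN2 h2, fun j => ?_⟩
    change N - t ≤ shiftMod q N (N - t) j
    rw [shiftMod_compl hm hN h1 h0]
    have := h3 j
    omega
  · intro s hs
    simp only [coe_filter, Set.mem_ofPred_eq] at hs ⊢
    have := key s hs.1
    omega
  · intro s hs
    simp only [coe_filter, mem_range, Set.mem_ofPred_eq] at hs ⊢
    omega

theorem exponent_le_of_pow_le {q u v y : ℕ} (hq : 2 ≤ q) (h : q ^ u ≤ q ^ v + y)
    (hy : y < q ^ v) : u ≤ v := by
  by_contra! hlt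
  have h1 : q ^ (v + 1) ≤ q ^ u := Nat.pow_le_pow_right (by omega) hlt
  rw [pow_succ] at h1
  nlinarith

theorem two_mul_pow_le {q u v : ℕ} (hq : 2 ≤ q) (h : u < v) : 2 * q ^ u ≤ q ^ v := by
  have h1 : q ^ (u + 1) ≤ q ^ v := Nat.pow_le_pow_right (by omega) h
  rw [pow_succ] at h1
  have := Nat.mul_le_mul_left (q ^ u) hq
  omega

theorem three_mul_pow_le {q u v : ℕ} (hq : 3 ≤ q) (h : u < v) : 3 * q ^ u ≤ q ^ v := by
  have h1 : q ^ (u + 1) ≤ q ^ v := Nat.pow_le_pow_right (by omega) h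
  rw [pow_succ] at h1
  have := Nat.mul_le_mul_left (q ^ u) hq
  omega

/-- Sums of powers are compared by comparing their two leading exponents lexicographically. -/
theorem exponents_lex_le {q u v e f y : ℕ} (hq : 2 ≤ q) (h : q ^ u + q ^ v ≤ q ^ e + q ^ f + y)
    (hf : f < e) (hy : y < q ^ f) : u ≤ e ∧ (u = e → v ≤ f) := by
  have h2 := two_mul_pow_le hq hf
  refine ⟨exponent_le_of_pow_le (y := q ^ f + y) hq (by omega) (by omega), ?_⟩
  rintro rfl
  exact exponent_le_of_pow_le hq (by omega) hy

theorem shiftMod_eq_of_add_eq {q m N t l V W : ℕ} (hN : N + 1 = q ^ m)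
    (h : t * q ^ l + W = V + W * q ^ m) (hV : V < N) : shiftMod q N t l = V := by
  have : t * q ^ l = V + N * W := by
    rw [← hN] at h
    linarith
  rw [shiftMod, this, Nat.add_mul_mod_self_left, Nat.mod_eq_of_lt hV]

theorem shiftMod_split {q N X Y f g : ℕ} (hfg : 0 < f + g) (hN : N + 1 = q ^ (f + g))
    (hY : Y < q ^ f) (h0 : 0 < X * q ^ f + Y) (h : X * q ^ f + Y < N) :
    shiftMod q N (X * q ^ f + Y) g = Y * q ^ g + X := by
  have hX : X < q ^ g := by
    by_contra! hX
    have := Nat.mul_le_mul_right (q ^ f) hX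
    rw [← pow_add, add_comm g f, ← hN] at this
    omega
  have hE : (X * q ^ f + Y) * q ^ g = (Y * q ^ g + X) + N * X := by
    have : X * (q ^ f * q ^ g) = X * (N + 1) := by rw [hN, pow_add]
    linarith
  have hle : Y * q ^ g + X ≤ N := by
    have := Nat.mul_le_mul_right (q ^ g) (Nat.succ_le_of_lt hY)
    rw [← pow_add, ← hN, Nat.succ_mul] at this
    omega
  have hne : Y * q ^ g + X ≠ N := by
    intro he
    have h1 := shiftMod_pos hfg hN h h0 g
    rw [shiftMod, hE, he] at h1
    simp at h1
  rw [shiftMod, hE, Nat.add_mul_mod_self_left, Nat.mod_eq_of_lt (by omega)]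

/-- If the leading base-`q` digit of a coset maximum is at most `1`, then so are all its digits,
and shifting any further digit `1` to the front does not increase the residue. -/
theorem IsOddTop.exists_next_digit {q M N t X Y f : ℕ} (hq : 2 ≤ q) (hN : N + 1 = q ^ (M + 1))
    (ht : IsOddTop q N t) (htM : t < 2 * q ^ M) (hf : f ≤ M + 1) (htX : t = X * q ^ f + Y)
    (hY0 : Y ≠ 0) (hY : Y < q ^ f) :
    ∃ e g r, f = e + g ∧ 1 ≤ g ∧ Y = q ^ e + r ∧ r < q ^ e ∧
      q ^ M + r * q ^ (M - e) + X * q ^ (g - 1) ≤ t := by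
  have he1 : q ^ Nat.log q Y ≤ Y := Nat.pow_log_le_self q hY0
  have he2 : Y < q ^ (Nat.log q Y + 1) := Nat.lt_pow_succ_log_self (by omega) Y
  have hef : Nat.log q Y < f := (Nat.pow_lt_pow_iff_right (by omega)).1 (he1.trans_lt hY)
  generalize Nat.log q Y = e at *
  obtain ⟨g, rfl⟩ : ∃ g, f = e + 1 + g := ⟨f - (e + 1), by omega⟩
  obtain ⟨d, rfl⟩ : ∃ d, M = e + d := ⟨M - e, by omega⟩
  have hXe : t = (X * q ^ g) * q ^ (e + 1) + Y := by rw [htX]; ring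
  have hs := shiftMod_split (X := X * q ^ g) (g := d) (f := e + 1) (by omega)
    (hN.trans (by congr 1; omega)) he2 (hXe ▸ ht.1) (hXe ▸ ht.2.1)
  rw [← hXe] at hs
  have hle := ht.2.2.2 d
  rw [hs] at hle
  obtain ⟨r, rfl⟩ := Nat.exists_eq_add_of_le he1
  have hr : r < q ^ e := by
    by_contra! hr
    have : 2 * q ^ e * q ^ d ≤ (q ^ e + r) * q ^ d := Nat.mul_le_mul_right _ (by omega)
    rw [pow_add] at htM
    nlinarith
  refine ⟨e, g + 1, r, by omega, by omega, rfl, hr, ?_⟩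
  rw [add_mul, ← pow_add] at hle
  simpa using hle

/-- Up to the bound `q ^ (3k-1) + q ^ (2k+1) + q ^ (k+2)`, odd coset maxima have one or three
nonzero digits, all equal to `1`. -/
theorem IsOddTop.classification {q k N t : ℕ} (hq : 3 ≤ q) (hqo : Odd q) (hk : 3 ≤ k)
    (hN : N + 1 = q ^ (3 * k - 1 + 1)) (ht : IsOddTop q N t)
    (hb : t ≤ q ^ (3 * k - 1) + q ^ (2 * k + 1) + q ^ (k + 2)) :
    t = q ^ (3 * k - 1) ∨ ∃ u v, v < u ∧ u < 3 * k - 1 ∧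
      t = q ^ (3 * k - 1) + q ^ u + q ^ v ∧
      (3 * k - 1 + v ≤ 2 * u ∧ 3 * k - 1 ≤ u + v ∨ u = 2 * k - 1 ∧ v = k - 1) := by
  have hq2 : 2 ≤ q := by omega
  generalize hM : 3 * k - 1 = M at *
  have hb1 := two_mul_pow_le hq2 (by omega : k + 2 < 2 * k + 1)
  have hb2 := two_mul_pow_le hq2 (by omega : 2 * k + 1 < M)
  have hkp : 0 < q ^ (k + 2) := by positivity
  have htM : t < 2 * q ^ M := by omega
  have hpo : ∀ x, q ^ x % 2 = 1 := fun x => Nat.odd_iff.1 hqo.pow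
  have hto : t % 2 = 1 := Nat.odd_iff.1 ht.2.2.1
  obtain ⟨e0, g0, r0, h0, hg0, ht0, hr0, I0⟩ := ht.exists_next_digit (X := 0) (Y := t)
    (f := M + 1) hq2 hN htM le_rfl (by simp) ht.1.ne' (by have := ht.2.1; omega)
  have he0 : e0 = M := by
    have := exponent_le_of_pow_le (u := M) hq2 (by omega) hr0
    omega
  subst he0
  by_cases hz0 : r0 = 0
  · left; omega
  right
  obtain ⟨e1, a, r1, h1, ha, rfl, hr1, I1⟩ := ht.exists_next_digit (X := 1) (Y := r0)
    (f := e0) hq2 hN htM (by omega) (by rw [ht0]; ring) hz0 hr0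
  by_cases hz1 : r1 = 0
  · have := hpo e0; have := hpo e1; omega
  obtain ⟨e2, b, r2, h2, hb', rfl, hr2, I2⟩ := ht.exists_next_digit (X := q ^ a + 1) (Y := r1)
    (f := e1) hq2 hN htM (by omega) (by rw [ht0, h1]; ring) hz1 hr1
  have J0 := exponents_lex_le (u := e1) (v := e2) (e := 2 * k + 1) (f := k + 2) (y := 0) hq2
    (by omega) (by omega) (by omega)
  have hs1 : e0 - e1 = a := by omega
  rw [hs1, add_mul, ← pow_add, one_mul] at I1
  by_cases hz2 : r2 = 0
  · subst hz2
    have J1 := exponents_lex_le (u := e2 + a) (v := a - 1) (e := e1) (f := e2) (y := 0) hq2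
      (by omega) (by omega) (by positivity)
    rw [add_mul, one_mul, ← pow_add] at I2
    have J2 := exponents_lex_le (u := a + (b - 1)) (v := b - 1) (e := e1) (f := e2) (y := 0) hq2
      (by omega) (by omega) (by positivity)
    exact ⟨e1, e2, by omega, by omega, by omega, by omega⟩
  exfalso
  obtain ⟨e3, c, r3, h3, hc, rfl, hr3, I3⟩ := ht.exists_next_digit
    (X := (q ^ a + 1) * q ^ b + 1) (Y := r2)
    (f := e2) hq2 hN htM (by omega) (by rw [ht0, h1, h2]; ring) hz2 hr2
  by_cases hz3 : r3 = 0
  · have := hpo e0; have := hpo e1; have := hpo e2; have := hpo e3; omega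
  obtain ⟨e4, d, r4, h4, hd, rfl, hr4, I4⟩ := ht.exists_next_digit
    (X := ((q ^ a + 1) * q ^ b + 1) * q ^ c + 1) (Y := r3)
    (f := e3) hq2 hN htM (by omega) (by rw [ht0, h1, h2, h3]; ring) hz3 hr3
  have J0' : ¬ (e1 = 2 * k + 1 ∧ e2 = k + 2) := by
    rintro ⟨rfl, rfl⟩
    omega
  have J1 := exponents_lex_le (u := e2 + a) (v := e3 + a) (e := e1) (f := e2) hq2
    (by rw [add_mul, ← pow_add] at I1; omega) (by omega) hr2
  have J2 := exponents_lex_le (u := e3 + (e0 - e2)) (v := e4 + (e0 - e2)) (e := e1) (f := e2) hq2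
    (by rw [add_mul, ← pow_add, add_mul, ← pow_add] at I2; omega) (by omega) hr2
  have J3 := exponents_lex_le (u := e4 + (e0 - e3)) (v := a + b + (c - 1)) (e := e1) (f := e2) hq2
    (by
      have : ((q ^ a + 1) * q ^ b + 1) * q ^ (c - 1) =
        q ^ (a + b + (c - 1)) + q ^ (b + (c - 1)) + q ^ (c - 1) := by ring
      rw [this, add_mul, ← pow_add] at I3; omega) (by omega) hr2
  have J4 := exponents_lex_le (u := a + b + c + (d - 1)) (v := b + c + (d - 1)) (e := e1)
    (f := e2) hq2
    (by
      have : (((q ^ a + 1) * q ^ b + 1) * q ^ c + 1) * q ^ (d - 1) =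
        q ^ (a + b + c + (d - 1)) + q ^ (b + c + (d - 1)) + q ^ (c + (d - 1)) + q ^ (d - 1) := by
          ring
      rw [this] at I4; omega) (by omega) hr2
  clear I0 I1 I2 I3 I4 hb ht0 htM hto hpo hN ht hr0 hr1 hr2 hr3 hr4 hz0 hz1 hz2 hz3 hb1 hb2 hkp
  omega

theorem pow_add_pow_lt {q x y u v : ℕ} (hq : 3 ≤ q)
    (h : x < u ∧ y < u ∨ x = u ∧ y < v) : q ^ x + q ^ y < q ^ u + q ^ v := by
  have hv : 0 < q ^ v := by positivity
  rcases h with ⟨h1, h2⟩ | ⟨rfl, h2⟩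
  · have := two_mul_pow_le (by omega : 2 ≤ q) h1
    have := two_mul_pow_le (by omega : 2 ≤ q) h2
    omega
  · have := two_mul_pow_le (by omega : 2 ≤ q) h2
    have : 0 < q ^ y := by positivity
    omega

theorem pow_add_pow_add_pow_lt {q x y z M R : ℕ} (hq : 3 ≤ q) (hx : x < M) (hy : y < M)
    (hz : z < M) (hR : 0 < R) : q ^ x + q ^ y + q ^ z < q ^ M + R := by
  have := three_mul_pow_le hq hx
  have := three_mul_pow_le hq hy
  have := three_mul_pow_le hq hz
  omega

theorem three_pow_lt {q M N a b c : ℕ} (hq : 3 ≤ q) (hN : N + 1 = q ^ (M + 1)) (hc : c < b)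
    (hb : b < M) (ha : a ≤ M) : q ^ a + q ^ b + q ^ c < N := by
  have h1 := three_mul_pow_le hq (by omega : M < M + 1)
  have h2 := two_mul_pow_le (by omega : 2 ≤ q) hc
  have h3 := two_mul_pow_le (by omega : 2 ≤ q) hb
  have h4 : q ^ a ≤ q ^ M := Nat.pow_le_pow_right (by omega) ha
  have h5 : 0 < q ^ c := by positivity
  omega

theorem odd_three_pow {q : ℕ} (hq : Odd q) (a b c : ℕ) : Odd (q ^ a + q ^ b + q ^ c) :=
  (hq.pow.add_odd hq.pow).add_odd hq.pow

theorem HasTopPeriod.isOddTop {q N t p : ℕ} (ht : t < N) (ho : Odd t)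
    (h : HasTopPeriod q N t p) : IsOddTop q N t :=
  ⟨ho.pos, ht, ho, h.le ht⟩

theorem hasTopPeriod_pow {q M N : ℕ} (hq : 3 ≤ q) (hN : N + 1 = q ^ (M + 1)) :
    q ^ M < N ∧ HasTopPeriod q N (q ^ M) (M + 1) := by
  have h1 := three_mul_pow_le hq (by omega : M < M + 1)
  have h2 : 0 < q ^ M := by positivity
  have hlt : q ^ M < N := by omega
  refine ⟨hlt, by omega, shiftMod_full hN hlt, fun l h0 hl => ?_⟩
  obtain ⟨l, rfl⟩ := Nat.exists_eq_add_of_le' h0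
  have h3 := two_mul_pow_le (by omega : 2 ≤ q) (by omega : l < M)
  have h4 : 0 < q ^ l := by positivity
  rw [shiftMod_eq_of_add_eq (V := q ^ l) (W := q ^ l) hN (by ring) (by omega)]
  omega

/-- Three digits `1` whose first cyclic gap is strictly smallest, in the lexicographic sense,
form a coset maximum with full period. -/
theorem hasTopPeriod_three_pow {q M N a b c : ℕ} (hq : 3 ≤ q) (hN : N + 1 = q ^ (M + 1))
    (hM : M = a + b + c) (ha : 1 ≤ a) (hab : a ≤ b) (hac : a ≤ c) :
    HasTopPeriod q N (q ^ M + q ^ (b + c) + q ^ c) (M + 1) := by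
  have hlt := three_pow_lt hq hN (by omega : c < b + c) (by omega) le_rfl
  refine ⟨by omega, shiftMod_full hN hlt, fun l h0 hl => ?_⟩
  obtain ⟨l, rfl⟩ := Nat.exists_eq_add_of_le' h0
  have hp : 0 < q ^ c := by positivity
  rcases lt_or_ge l a with h1 | h1
  · have hV : q ^ (b + c + (l + 1)) + q ^ (c + (l + 1)) + q ^ l <
        q ^ M + q ^ (b + c) + q ^ c := by
      rcases Nat.lt_or_ge (l + 1) a with h2 | h2
      · have := pow_add_pow_add_pow_lt hq (by omega : b + c + (l + 1) < M)
          (by omega : c + (l + 1) < M) (by omega : l < M) (by positivity : 0 < q ^ (b + c) + q ^ c)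
        omega
      · have := pow_add_pow_lt hq (x := c + (l + 1)) (y := l) (u := b + c) (v := c) (by omega)
        rw [show b + c + (l + 1) = M by omega]
        omega
    rwa [shiftMod_eq_of_add_eq (W := q ^ l) hN (by ring) (hV.trans hlt)]
  rcases lt_or_ge l (a + b) with h2 | h2
  · obtain ⟨l, rfl⟩ := Nat.exists_eq_add_of_le h1
    have hV : q ^ (c + (a + l + 1)) + q ^ (a + l) + q ^ l < q ^ M + q ^ (b + c) + q ^ c := by
      rcases Nat.lt_or_ge (l + 1) b with h2 | h2
      · have := pow_add_pow_add_pow_lt hq (by omega : c + (a + l + 1) < M)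
          (by omega : a + l < M) (by omega : l < M) (by positivity : 0 < q ^ (b + c) + q ^ c)
        omega
      · have := pow_add_pow_lt hq (x := a + l) (y := l) (u := b + c) (v := c) (by omega)
        rw [show c + (a + l + 1) = M by omega]
        omega
    rwa [shiftMod_eq_of_add_eq (W := q ^ (a + l) + q ^ l) hN (by rw [hM]; ring) (hV.trans hlt)]
  · obtain ⟨l, rfl⟩ := Nat.exists_eq_add_of_le h2
    have hV : q ^ (a + b + l) + q ^ (b + l) + q ^ l < q ^ M + q ^ (b + c) + q ^ c := by
      have := pow_add_pow_add_pow_lt hq (by omega : a + b + l < M)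
          (by omega : b + l < M) (by omega : l < M) (by positivity : 0 < q ^ (b + c) + q ^ c)
      omega
    rwa [shiftMod_eq_of_add_eq (W := q ^ (a + b + l) + q ^ (b + l) + q ^ l) hN (by rw [hM]; ring)
      (hV.trans hlt)]

/-- Three equally spaced digits `1` form a coset maximum whose period is the spacing. -/
theorem hasTopPeriod_equally_spaced {q k N : ℕ} (hq : 3 ≤ q) (hk : 1 ≤ k)
    (hN : N + 1 = q ^ (3 * k - 1 + 1)) :
    HasTopPeriod q N (q ^ (3 * k - 1) + q ^ (2 * k - 1) + q ^ (k - 1)) k := by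
  have hlt := three_pow_lt hq hN (by omega : k - 1 < 2 * k - 1) (by omega) le_rfl
  obtain ⟨c, rfl⟩ := Nat.exists_eq_add_of_le' hk
  simp only [(by omega : 3 * (c + 1) - 1 = 3 * c + 2), (by omega : 2 * (c + 1) - 1 = 2 * c + 1),
    Nat.add_sub_cancel] at *
  refine ⟨by omega, shiftMod_eq_of_add_eq (W := q ^ c) hN (by ring) hlt, fun l h0 hl => ?_⟩
  obtain ⟨l, rfl⟩ := Nat.exists_eq_add_of_le' h0
  have hV := pow_add_pow_add_pow_lt hq (by omega : 2 * c + 1 + (l + 1) < 3 * c + 2)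
    (by omega : c + (l + 1) < 3 * c + 2) (by omega : l < 3 * c + 2)
    (by positivity : 0 < q ^ (2 * c + 1) + q ^ c)
  rw [shiftMod_eq_of_add_eq (V := q ^ (2 * c + 1 + (l + 1)) + q ^ (c + (l + 1)) + q ^ l)
    (W := q ^ l) hN (by ring) (by omega)]
  omega

theorem hasTopPeriod_exponents {q M N u v : ℕ} (hq : 3 ≤ q) (hN : N + 1 = q ^ (M + 1))
    (huM : u < M) (hvu : v < u) (h1 : M + v ≤ 2 * u) (h2 : M ≤ u + v) :
    HasTopPeriod q N (q ^ M + q ^ u + q ^ v) (M + 1) := by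
  have := hasTopPeriod_three_pow (a := M - u) (b := u - v) (c := v) hq hN (by omega) (by omega)
    (by omega) (by omega)
  rwa [Nat.sub_add_cancel hvu.le] at this

open Classical in
/-- There are at least ten odd coset maxima up to `q ^ (3k-1) + q ^ (2k+1) + q ^ (k+2)`. -/
theorem le_of_card_isOddTop_le_ten {q k N τ : ℕ} (hq : 3 ≤ q) (hqo : Odd q) (hk : 3 ≤ k)
    (hN : N + 1 = q ^ (3 * k - 1 + 1)) (hτ : IsOddTop q N τ)
    (hcard : ((range N).filter fun t => IsOddTop q N t ∧ t ≤ τ).card ≤ 10) :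
    τ ≤ q ^ (3 * k - 1) + q ^ (2 * k + 1) + q ^ (k + 2) := by
  by_contra! hlt
  have top : ∀ u v, u < 3 * k - 1 → v < u → 3 * k - 1 + v ≤ 2 * u → 3 * k - 1 ≤ u + v →
      IsOddTop q N (q ^ (3 * k - 1) + q ^ u + q ^ v) := fun u v h1 h2 h3 h4 =>
    (hasTopPeriod_exponents hq hN h1 h2 h3 h4).isOddTop
      (three_pow_lt hq hN h2 h1 le_rfl) (odd_three_pow hqo _ _ _)
  have T1 := (hasTopPeriod_pow hq hN).2.isOddTop (hasTopPeriod_pow hq hN).1 hqo.pow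
  have T2 := (hasTopPeriod_equally_spaced hq (by omega) hN).isOddTop
    (three_pow_lt hq hN (by omega) (by omega) le_rfl) (odd_three_pow hqo _ _ _)
  have T3 := top (2 * k) (k - 1) (by omega) (by omega) (by omega) (by omega)
  have T4 := top (2 * k) k (by omega) (by omega) (by omega) (by omega)
  have T5 := top (2 * k) (k + 1) (by omega) (by omega) (by omega) (by omega)
  have T6 := top (2 * k + 1) (k - 2) (by omega) (by omega) (by omega) (by omega)
  have T7 := top (2 * k + 1) (k - 1) (by omega) (by omega) (by omega) (by omega)
  have T8 := top (2 * k + 1) k (by omega) (by omega) (by omega) (by omega)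
  have T9 := top (2 * k + 1) (k + 1) (by omega) (by omega) (by omega) (by omega)
  have T10 := top (2 * k + 1) (k + 2) (by omega) (by omega) (by omega) (by omega)
  have L1 : 0 < q ^ (2 * k - 1) := by positivity
  have L2 := pow_add_pow_lt hq (x := 2 * k - 1) (y := k - 1) (u := 2 * k) (v := k - 1) (by omega)
  have L3 := pow_add_pow_lt hq (x := 2 * k) (y := k - 1) (u := 2 * k) (v := k) (by omega)
  have L4 := pow_add_pow_lt hq (x := 2 * k) (y := k) (u := 2 * k) (v := k + 1) (by omega)
  have L5 := pow_add_pow_lt hq (x := 2 * k) (y := k + 1) (u := 2 * k + 1) (v := k - 2) (by omega)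
  have L6 := pow_add_pow_lt hq (x := 2 * k + 1) (y := k - 2) (u := 2 * k + 1) (v := k - 1)
    (by omega)
  have L7 := pow_add_pow_lt hq (x := 2 * k + 1) (y := k - 1) (u := 2 * k + 1) (v := k) (by omega)
  have L8 := pow_add_pow_lt hq (x := 2 * k + 1) (y := k) (u := 2 * k + 1) (v := k + 1) (by omega)
  have L9 := pow_add_pow_lt hq (x := 2 * k + 1) (y := k + 1) (u := 2 * k + 1) (v := k + 2)
    (by omega)
  let f : Fin 11 → ℕ := ![q ^ (3 * k - 1), q ^ (3 * k - 1) + q ^ (2 * k - 1) + q ^ (k - 1),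
    q ^ (3 * k - 1) + q ^ (2 * k) + q ^ (k - 1), q ^ (3 * k - 1) + q ^ (2 * k) + q ^ k,
    q ^ (3 * k - 1) + q ^ (2 * k) + q ^ (k + 1), q ^ (3 * k - 1) + q ^ (2 * k + 1) + q ^ (k - 2),
    q ^ (3 * k - 1) + q ^ (2 * k + 1) + q ^ (k - 1), q ^ (3 * k - 1) + q ^ (2 * k + 1) + q ^ k,
    q ^ (3 * k - 1) + q ^ (2 * k + 1) + q ^ (k + 1),
    q ^ (3 * k - 1) + q ^ (2 * k + 1) + q ^ (k + 2), τ]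
  have hmono : StrictMono f := by
    rw [Fin.strictMono_iff_lt_succ]
    intro i
    fin_cases i <;> simp [f] <;> omega
  have htop : ∀ i, IsOddTop q N (f i) := by
    intro i
    fin_cases i <;> simp only [f] <;> assumption
  have hle : (univ.image f).card ≤ ((range N).filter fun t => IsOddTop q N t ∧ t ≤ τ).card := by
    apply card_le_card
    intro x hx
    obtain ⟨i, -, rfl⟩ := mem_image.1 hx
    simp only [mem_filter, mem_range]
    exact ⟨(htop i).2.1, htop i, hmono.monotone (Fin.le_last i)⟩
  rw [card_image_of_injective _ hmono.injective] at hle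
  simp at hle
  omega

open Classical in
/-- If `τ` is the `i`-th smallest odd coset maximum, `2 ≤ i ≤ 10`, then the cosets of the odd
coset maxima up to `τ` consist of one coset of size `k` and `i - 1` cosets of size `3k`. -/
theorem card_bounded_orbits_of_card_isOddTop {q k N i τ : ℕ} (hq : 3 ≤ q) (hqo : Odd q)
    (hk : 3 ≤ k) (hN : N + 1 = q ^ (3 * k - 1 + 1)) (hτ : IsOddTop q N τ)
    (hi1 : 2 ≤ i) (hi2 : i ≤ 10)
    (hcard : ((range N).filter fun t => IsOddTop q N t ∧ t ≤ τ).card = i) :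
    ((range N).filter fun t => Odd t ∧ ∀ j, shiftMod q N t j ≤ τ).card =
      (i - 1) * (3 * k) + k := by
  have hb := le_of_card_isOddTop_le_ten hq hqo hk hN hτ (hcard.trans_le hi2)
  set t₂ := q ^ (3 * k - 1) + q ^ (2 * k - 1) + q ^ (k - 1) with ht₂
  have P2 := hasTopPeriod_equally_spaced hq (by omega) hN
  have T2 := P2.isOddTop
    (three_pow_lt hq hN (by omega) (by omega) le_rfl) (odd_three_pow hqo _ _ _)
  rw [← ht₂] at P2 T2
  have hmem : t₂ ∈ (range N).filter fun t => IsOddTop q N t ∧ t ≤ τ := by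
    simp only [mem_filter, mem_range]
    refine ⟨T2.2.1, T2, ?_⟩
    by_contra! hlt
    have hsub : ((range N).filter fun t => IsOddTop q N t ∧ t ≤ τ) ⊆ {q ^ (3 * k - 1)} := by
      intro t ht
      simp only [mem_filter, mem_range] at ht
      rw [mem_singleton]
      rcases ht.2.1.classification hq hqo hk hN (by omega) with h | ⟨u, v, h1, h2, h3, h4⟩
      · exact h
      · have : t₂ ≤ t := by
          rcases h4 with h4 | ⟨rfl, rfl⟩
          · have := pow_add_pow_lt hq (x := 2 * k - 1) (y := k - 1) (u := u) (v := v) (by omega)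
            omega
          · omega
        omega
    have := card_le_card hsub
    rw [hcard, card_singleton] at this
    omega
  rw [card_bounded_orbits hqo (by omega) hN (fun t => if t = t₂ then k else 3 * k) ?_,
    ← add_sum_erase _ _ hmem, if_pos rfl,
    sum_congr rfl (fun t ht => if_neg (ne_of_mem_erase ht)), sum_const, smul_eq_mul,
    card_erase_of_mem hmem, hcard, add_comm]
  intro t ht htτ
  have h3k : 3 * k - 1 + 1 = 3 * k := by omega
  split_ifs with h
  · rwa [h]
  rcases ht.classification hq hqo hk hN (by omega) with rfl | ⟨u, v, h1, h2, h3, h4⟩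
  · simpa only [h3k] using (hasTopPeriod_pow hq hN).2
  · rcases h4 with h4 | ⟨rfl, rfl⟩
    · rw [h3]
      simpa only [h3k] using hasTopPeriod_exponents hq hN h2 h1 h4.1 h4.2
    · exact absurd h3 h

theorem stmt_8 (q m n i δ' : ℕ)
    (hq : ∃ p e : ℕ, p.Prime ∧ Odd p ∧ 0 < e ∧ q = p ^ e)
    (hq3 : 3 ≤ q) (hm : 9 ≤ m) (hm3 : m % 3 = 0) (hn : 2 * n = q ^ m - 1)
    (hi1 : 2 ≤ i) (hi2 : i ≤ 10)
    (hδ' : IsIthLargest (oddLeaders q (2 * n)) i δ')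
    (F E : Type*) [Field F] [Fintype F] [Field E] [Algebra F E]
    (hF : Fintype.card F = q)
    (γ : E) (hγ : IsPrimitiveRoot γ (2 * n)) :
    Module.finrank F (negaBCH F n γ ((δ' + 1) / 2) 0) = i * m - 2 * m / 3 ∧
    {s : ℕ | 1 ≤ s ∧ s ≤ 2 * n - 1 ∧ Odd s ∧
      (s : ZMod (2 * n)) ∉ ⋃ t ∈ Set.Icc 1 (δ' - 2), qCoset q (2 * n) t}.ncard = i * m - 2 * m / 3 := by
  classical
  obtain ⟨p, e, -, hp, -, hpe⟩ := hq
  have hqo : Odd q := hpe ▸ hp.pow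
  obtain ⟨k, rfl⟩ : ∃ k, m = 3 * k := ⟨m / 3, by omega⟩
  have hm0 : 0 < 3 * k := by omega
  have hN : 2 * n + 1 = q ^ (3 * k) := by
    have : 0 < q ^ (3 * k) := by positivity
    omega
  have hN' : 2 * n + 1 = q ^ (3 * k - 1 + 1) := by rw [hN, Nat.sub_add_cancel hm0]
  have hN2 : Even (2 * n) := even_two_mul n
  obtain ⟨hlt, hodd, htop, hcard⟩ := hδ'.compl hm0 hN hN2
  have hcount := card_bounded_orbits_of_card_isOddTop hq3 hqo (by omega) hN' htop hi1 hi2 hcard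
  have hval : (i - 1) * (3 * k) + k = i * (3 * k) - 2 * (3 * k) / 3 := by
    obtain ⟨i, rfl⟩ := Nat.exists_eq_add_of_le' hi1
    have h1 : (i + 2) * (3 * k) = (i + 2 - 1) * (3 * k) + 3 * k := by
      rw [← Nat.succ_mul]; rfl
    omega
  have hd3 : 3 ≤ δ' := by
    have hb := le_of_card_isOddTop_le_ten hq3 hqo (by omega) hN' htop (hcard.trans_le hi2)
    have h1 := two_mul_pow_le (by omega : 2 ≤ q) (by omega : k + 2 < 2 * k + 1)
    have h2 := two_mul_pow_le (by omega : 2 ≤ q) (by omega : 2 * k + 1 < 3 * k - 1)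
    have h3 := three_mul_pow_le hq3 (by omega : 3 * k - 1 < 3 * k - 1 + 1)
    have h4 : 0 < q ^ (k + 2) := by positivity
    omega
  have hcompl := card_filter_compl hm0 hN hN2 (Nat.sub_le (2 * n) δ')
  rw [Nat.sub_sub_self hlt.le, hcount, hval] at hcompl
  refine ⟨(finrank_negaBCH_eq_card hqo hm0 hN hodd hd3 hlt hF hγ).trans hcompl, ?_⟩
  rw [← hcompl, ← Set.ncard_coe_finset]
  congr 1
  ext s
  simp only [Set.mem_ofPred_eq, coe_filter, mem_range]
  constructor
  · rintro ⟨h1, h2, h3, h4⟩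
    rw [mem_iUnion_qCoset_iff hqo hm0 hN hodd hlt (by omega) h3] at h4
    exact ⟨by omega, h3, by simpa using h4⟩
  · rintro ⟨h1, h2, h3⟩
    refine ⟨h2.pos, by omega, h2, ?_⟩
    rw [mem_iUnion_qCoset_iff hqo hm0 hN hodd hlt h1 h2]
    simpa using h3
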